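/- Let H be a discrete ω-dimensional poc-set, let Σ be an almost-equality class of H°, and let ξ ∈ Σ. Suppose the set of ∼-equivalence classes of infinite strictly descending chains contained in ξ is finite of cardinality δ > 0. Then there exists an almost-equality class Σ₁ of H° with Σ₁ ≠ Σ and Σ ⊆ cl(Σ₁) (i.e., Σ₁ < Σ in the Roller boundary order), and there exists ξ₁ ∈ Σ₁ such that the set of ∼-equivalence classes of infinite strictly descending chains contained in ξ₁ has cardinality δ − 1. -/

import Mathlib

universe u

/-- A poc-set: a partially ordered set with minimum `zero` and an order-reversing
involution `star` such that `h ≤ star h` implies `h = zero`. -/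
structure PocSet (H : Type u) [PartialOrder H] : Type u where
  star : H → H
  zero : H
  zero_le : ∀ h : H, zero ≤ h
  star_star : ∀ h : H, star (star h) = h
  star_antitone : ∀ a b : H, a ≤ b → star b ≤ star a
  eq_zero_of_le_star : ∀ h : H, h ≤ star h → h = zero

namespace PocSet

variable {H : Type u} [PartialOrder H]

/-- An element is proper if it is neither `0` nor `0*`. -/
def Proper (P : PocSet H) (h : H) : Prop := h ≠ P.zero ∧ h ≠ P.star P.zero

/-- A poc-set is discrete if every interval between proper elements is finite. -/
def IsDiscrete (P : PocSet H) : Prop :=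
  ∀ a b : H, P.Proper a → P.Proper b → (Set.Icc a b).Finite

/-- Two elements are transverse if none of the four nesting relations holds. -/
def Transverse (P : PocSet H) (a b : H) : Prop :=
  ¬ a ≤ b ∧ ¬ P.star a ≤ b ∧ ¬ a ≤ P.star b ∧ ¬ P.star a ≤ P.star b

/-- ω-dimensionality: no infinite subset of pairwise transverse elements. -/
def OmegaDimensional (P : PocSet H) : Prop :=
  ∀ S : Set H, S.Pairwise P.Transverse → S.Finite

/-- Ultrafilter on a poc-set: (UF1) exactly one of `h`, `h*` belongs;
(UF2) no `h ≤ k*` for members `h, k`. -/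
def IsUltra (P : PocSet H) (α : Set H) : Prop :=
  (∀ h : H, h ∈ α ↔ P.star h ∉ α) ∧ ∀ h ∈ α, ∀ k ∈ α, ¬ h ≤ P.star k

/-- An infinite strictly descending chain of elements of `ξ`. -/
def DescChainIn (ξ : Set H) (c : ℕ → H) : Prop :=
  (∀ n, c n ∈ ξ) ∧ ∀ n, c (n + 1) < c n

/-- Principal ultrafilter: an ultrafilter with no infinite strictly descending chain. -/
def IsPrincipal (P : PocSet H) (α : Set H) : Prop :=
  P.IsUltra α ∧ ¬ ∃ c : ℕ → H, DescChainIn α c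

/-- The set of minimal elements of `α`. -/
def minset (α : Set H) : Set H := {a ∈ α | ∀ b ∈ α, b ≤ a → b = a}

/-- Almost equality: both differences are finite. -/
def AlmostEq (α β : Set H) : Prop := (α \ β).Finite ∧ (β \ α).Finite

/-- `Sg` is an almost-equality class of ultrafilters on `P`. -/
def IsAEClass (P : PocSet H) (Sg : Set (Set H)) : Prop :=
  ∃ α : Set H, P.IsUltra α ∧ Sg = {β | P.IsUltra β ∧ AlmostEq α β}

-- The Tychonoff topology on subsets of `H`, induced from the product topology
-- on `H → Bool` (with `Bool` discrete) via characteristic functions.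
open Classical in
noncomputable def tychonoff (H : Type u) : TopologicalSpace (Set H) :=
  TopologicalSpace.induced (fun (α : Set H) (h : H) => decide (h ∈ α)) inferInstance

/-- The median of three subsets of `H`. -/
def med (α β γ : Set H) : Set H := (α ∩ β) ∪ (β ∩ γ) ∪ (α ∩ γ)

end PocSet

open PocSet

open PocSet

/-- `c` dominates `d`: every element of `d` lies above some element of `c`. -/
def Dominates {H : Type u} [PartialOrder H] (c d : ℕ → H) : Prop :=
  ∀ m : ℕ, ∃ n : ℕ, c n ≤ d m

/-- Equivalence of infinite descending chains. -/
def ChainEquiv {H : Type u} [PartialOrder H] (c d : ℕ → H) : Prop :=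
  Dominates c d ∧ Dominates d c

/-- The set of `ChainEquiv`-classes of infinite strictly descending chains contained
in `ξ` has exactly `δ` elements. -/
def ChainClassesCard {H : Type u} [PartialOrder H] (ξ : Set H) (δ : ℕ) : Prop :=
  ∃ reps : Fin δ → ℕ → H,
    (∀ i, DescChainIn ξ (reps i)) ∧
    (∀ i j, i ≠ j → ¬ ChainEquiv (reps i) (reps j)) ∧
    ∀ c : ℕ → H, DescChainIn ξ c → ∃ i, ChainEquiv c (reps i)

namespace PocSet

variable {H : Type u} [PartialOrder H] {P : PocSet H}

theorem le_star_zero (P : PocSet H) (h : H) : h ≤ P.star P.zero := by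
  simpa [P.star_star] using P.star_antitone _ _ (P.zero_le (P.star h))

theorem IsUltra.zero_notMem {α : Set H} (hα : P.IsUltra α) : P.zero ∉ α :=
  fun h => hα.2 _ h _ h (P.zero_le _)

/-- Replace every element of `A` by its complement. -/
def flip (P : PocSet H) (α A : Set H) : Set H := {h | (h ∈ α ∧ h ∉ A) ∨ P.star h ∈ A}

theorem IsUltra.flip {α A : Set H} (hα : P.IsUltra α) (hA : A ⊆ α)
    (hdown : ∀ h ∈ α, ∀ k ∈ A, h ≤ k → h ∈ A)
    (hdisj : ∀ h ∈ A, ∀ k ∈ A, ¬ P.star h ≤ k) : P.IsUltra (P.flip α A) := by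
  constructor
  · intro h
    have h1 := hα.1 h
    have h2 := @hA h
    have h3 := @hA (P.star h)
    simp only [PocSet.flip, Set.mem_ofPred_eq, P.star_star]
    tauto
  · rintro h (⟨hh, hA'⟩ | hh) k (⟨hk, kA⟩ | hk) hle
    · exact hα.2 h hh k hk hle
    · exact hA' (hdown h hh _ hk hle)
    · have := P.star_antitone _ _ hle
      rw [P.star_star] at this
      exact kA (hdown k hk _ hh this)
    · exact hdisj _ hh _ hk (by rwa [P.star_star])

theorem AlmostEq.symm {X : Type*} {α β : Set X} (h : AlmostEq α β) : AlmostEq β α := ⟨h.2, h.1⟩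

theorem AlmostEq.trans {X : Type*} {α β γ : Set X} (h : AlmostEq α β) (k : AlmostEq β γ) :
    AlmostEq α γ := by
  refine ⟨(h.1.union k.1).subset ?_, (h.2.union k.2).subset ?_⟩ <;>
  · intro x
    simp only [Set.mem_union, Set.mem_sdiff]
    tauto

/-- Sets that agree outside a finite set `S` and its complements are almost equal. -/
theorem almostEq_of_finite (P : PocSet H) {α β S : Set H} (hS : S.Finite)
    (h : ∀ x, x ∉ S → P.star x ∉ S → (x ∈ α ↔ x ∈ β)) : AlmostEq α β := by
  have hfin : (S ∪ P.star '' S).Finite := hS.union (hS.image _)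
  have key : ∀ x, x ∉ S ∪ P.star '' S → (x ∈ α ↔ x ∈ β) := fun x hx =>
    h x (fun hs => hx (Or.inl hs)) (fun hs => hx (Or.inr ⟨_, hs, P.star_star x⟩))
  constructor <;> refine hfin.subset fun x hx => ?_ <;> by_contra hn
  · exact hx.2 ((key x hn).1 hx.1)
  · exact hx.2 ((key x hn).2 hx.1)

/-- The elements of `α` below `c` that are not above any element of `G`. -/
def below (α : Set H) (c : H) (G : Set H) : Set H := {h | h ∈ α ∧ h ≤ c ∧ ∀ g ∈ G, ¬ g ≤ h}

theorem IsUltra.flip_below {α : Set H} (hα : P.IsUltra α) {c : H} (hc : c ≠ P.star P.zero)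
    (G : Set H) : P.IsUltra (P.flip α (below α c G)) := by
  refine hα.flip (fun h hh => hh.1) ?_ ?_
  · exact fun h hh k hk hle => ⟨hh, hle.trans hk.2.1, fun g hg hgh => hk.2.2 g hg (hgh.trans hle)⟩
  · intro h hh k hk hle
    have h1 : P.star c ≤ P.star (P.star c) := by
      rw [P.star_star]
      exact (P.star_antitone _ _ hh.2.1).trans (hle.trans hk.2.1)
    have := P.eq_zero_of_le_star _ h1
    exact hc (by rw [← this, P.star_star])

theorem IsUltra.proper_of_le {α : Set H} (hα : P.IsUltra α) {c h : H}
    (hc : c ≠ P.star P.zero) (hh : h ∈ α) (hle : h ≤ c) : P.Proper h :=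
  ⟨fun e => hα.zero_notMem (e ▸ hh),
    fun e => hc (le_antisymm (P.le_star_zero c) (e ▸ hle))⟩

theorem mem_closure_tychonoff {H : Type u} {S : Set (Set H)} {β : Set H}
    (h : ∀ F : Finset H, ∃ γ ∈ S, ∀ x ∈ F, (x ∈ γ ↔ x ∈ β)) :
    letI : TopologicalSpace (Set H) := tychonoff H
    β ∈ closure S := by
  classical
  refine (closure_induced (f := fun (α : Set H) (h : H) => decide (h ∈ α))).2 ?_
  rw [mem_closure_iff]
  intro o ho hβ
  obtain ⟨I, u, hu, hsub⟩ := isOpen_pi_iff.1 ho _ hβ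
  obtain ⟨γ, hγ, hF⟩ := h I
  refine ⟨_, hsub ?_, γ, hγ, rfl⟩
  intro x hx
  have h2 := (hu x hx).2
  have h3 := hF x hx
  simpa only [h3] using h2

/-- Every ultrafilter almost equal to `ξ` is a limit of the almost-equality class obtained by
flipping the elements of `ξ` below a proper `c`. -/
theorem mem_closure_flip_below (hdisc : P.IsDiscrete) {ξ β : Set H} (hβ : P.IsUltra β)
    (hξβ : AlmostEq ξ β) {c : H} (hc : P.Proper c) :
    letI : TopologicalSpace (Set H) := tychonoff H
    β ∈ closure {γ | P.IsUltra γ ∧ AlmostEq (P.flip ξ (below ξ c ∅)) γ} := by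
  refine mem_closure_tychonoff fun F => ?_
  let G : Set H := {g | g ∈ (F : Set H) ∪ P.star '' F ∧ g ∈ β ∧ g ≤ c}
  have hG : G.Finite :=
    (F.finite_toSet.union (F.finite_toSet.image _)).subset fun g hg => hg.1
  have hself : ∀ x, x ∈ (F : Set H) ∪ P.star '' F → x ∉ below β c G :=
    fun x hx hb => hb.2.2 x ⟨hx, hb.1, hb.2.1⟩ le_rfl
  refine ⟨P.flip β (below β c G), ⟨hβ.flip_below hc.2 G, ?_⟩, ?_⟩
  · have hS : ((ξ \ β ∪ β \ ξ) ∪ ⋃ g ∈ G, Set.Icc g c).Finite :=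
      (hξβ.1.union hξβ.2).union
        (hG.biUnion fun g hg => hdisc g c (hβ.proper_of_le hc.2 hg.2.1 hg.2.2) hc)
    have key : ∀ x, x ∉ (ξ \ β ∪ β \ ξ) ∪ ⋃ g ∈ G, Set.Icc g c →
        ((x ∈ ξ ↔ x ∈ β) ∧ (x ∈ below ξ c ∅ ↔ x ∈ below β c G)) := by
      intro x hx
      simp only [Set.mem_union, Set.mem_sdiff, Set.mem_iUnion, Set.mem_Icc, not_or, not_exists,
        not_and] at hx
      have h1 : x ∈ ξ ↔ x ∈ β := by tauto
      refine ⟨h1, ⟨fun h => ⟨h1.1 h.1, h.2.1, fun g hg hgx => hx.2 g hg hgx h.2.1⟩,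
        fun h => ⟨h1.2 h.1, h.2.1, fun g hg => hg.elim⟩⟩⟩
    refine almostEq_of_finite P hS fun x hx hx' => ?_
    simp only [flip, Set.mem_ofPred_eq, (key x hx).1, (key x hx).2, (key _ hx').2]
  · intro x hx
    have h1 := hself x (Or.inl hx)
    have h2 := hself _ (Or.inr ⟨x, hx, rfl⟩)
    simp only [flip, Set.mem_ofPred_eq]
    tauto

theorem DescChainIn.strictAnti {ξ : Set H} {c : ℕ → H} (hc : DescChainIn ξ c) : StrictAnti c :=
  strictAnti_nat_of_succ_lt hc.2

theorem DescChainIn.proper_succ {ξ : Set H} (hξ : P.IsUltra ξ) {c : ℕ → H}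
    (hc : DescChainIn ξ c) (n : ℕ) : P.Proper (c (n + 1)) :=
  ⟨fun e => hξ.zero_notMem (e ▸ hc.1 (n + 1)),
    fun e => (hc.2 n).not_ge (e ▸ P.le_star_zero (c n))⟩

/-- A descending chain in the flipped ultrafilter eventually consists of unflipped elements. -/
theorem DescChainIn.eventually_mem (hdisc : P.IsDiscrete) {ξ : Set H} (hξ : P.IsUltra ξ) {c : H}
    (hc : P.Proper c) {G : Set H} {e : ℕ → H} (he : DescChainIn (P.flip ξ (below ξ c G)) e) :
    ∃ n, ∀ m, n ≤ m → e m ∈ ξ ∧ e m ∉ below ξ c G := by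
  by_contra! hcon
  have hfreq : ∀ n, ∃ m, n ≤ m ∧ P.star (e m) ∈ below ξ c G := by
    intro n
    obtain ⟨m, hm, hm'⟩ := hcon n
    refine ⟨m, hm, ?_⟩
    rcases he.1 m with h | h
    · exact absurd (hm' h.1) h.2
    · exact h
  obtain ⟨m₀, -, h₀⟩ := hfreq 0
  have hfin := hdisc _ _ (hξ.proper_of_le hc.2 h₀.1 h₀.2.1) hc
  have hinj : Function.Injective fun m => P.star (e m) := fun a b hab => by
    have := congrArg P.star hab
    simp only [P.star_star] at this
    exact he.strictAnti.injective this
  have hinf : {m | m₀ ≤ m ∧ P.star (e m) ∈ below ξ c G}.Infinite := by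
    refine Set.infinite_of_not_bddAbove ?_
    rintro ⟨b, hb⟩
    obtain ⟨m, hm, hm'⟩ := hfreq (max m₀ (b + 1))
    have := hb (show m ∈ _ from ⟨(le_max_left _ _).trans hm, hm'⟩)
    have := (le_max_right m₀ (b + 1)).trans hm
    omega
  refine hinf.image hinj.injOn (hfin.subset ?_)
  rintro _ ⟨m, ⟨hm, hm'⟩, rfl⟩
  exact ⟨P.star_antitone _ _ (he.strictAnti.antitone hm), hm'.2.1⟩

end PocSet

section Chains

variable {H : Type*} [PartialOrder H]

theorem Dominates.trans {a b c : ℕ → H} (h : Dominates a b) (k : Dominates b c) :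
    Dominates a c := fun m => by
  obtain ⟨n, hn⟩ := k m
  obtain ⟨l, hl⟩ := h n
  exact ⟨l, hl.trans hn⟩

theorem ChainEquiv.trans {a b c : ℕ → H} (h : ChainEquiv a b) (k : ChainEquiv b c) :
    ChainEquiv a c := ⟨h.1.trans k.1, k.2.trans h.2⟩

theorem chainEquiv_shift {c : ℕ → H} (hc : Antitone c) (k : ℕ) :
    ChainEquiv c fun n => c (n + k) :=
  ⟨fun m => ⟨m + k, le_rfl⟩, fun m => ⟨m, hc (Nat.le_add_right m k)⟩⟩

theorem exists_maximal_chain {n : ℕ} (reps : Fin (n + 1) → ℕ → H) :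
    ∃ i, ∀ j, Dominates (reps j) (reps i) → Dominates (reps i) (reps j) := by
  let r : Fin (n + 1) → Fin (n + 1) → Prop := fun i j =>
    Dominates (reps i) (reps j) ∧ ¬ Dominates (reps j) (reps i)
  have : IsTrans _ r := ⟨fun a b c h k =>
    ⟨h.1.trans k.1, fun l => k.2 (l.trans h.1)⟩⟩
  have : Std.Irrefl r := ⟨fun a h => h.2 h.1⟩
  obtain ⟨i, -, hi⟩ :=
    (Finite.wellFounded_of_trans_of_irrefl r).has_min Set.univ Set.univ_nonempty
  exact ⟨i, fun j hj => by_contra fun h => hi j trivial ⟨hj, h⟩⟩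

end Chains

theorem stmt14 {H : Type u} [PartialOrder H] (P : PocSet H)
    (hdisc : P.IsDiscrete) (homega : P.OmegaDimensional)
    (Sg : Set (Set H)) (hSg : IsAEClass P Sg) (ξ : Set H) (hξ : ξ ∈ Sg)
    (δ : ℕ) (hδ : 0 < δ) (hcard : ChainClassesCard ξ δ) :
    (letI : TopologicalSpace (Set H) := tychonoff H
     ∃ Sg1 : Set (Set H), IsAEClass P Sg1 ∧ Sg1 ≠ Sg ∧ Sg ⊆ closure Sg1 ∧
       ∃ ξ1 ∈ Sg1, ChainClassesCard ξ1 (δ - 1)) := by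
  obtain ⟨α, hα, rfl⟩ := hSg
  obtain ⟨hξU, hαξ⟩ := hξ
  obtain ⟨m, rfl⟩ : ∃ m, δ = m + 1 := ⟨δ - 1, by omega⟩
  obtain ⟨reps, hreps, hne, hall⟩ := hcard
  obtain ⟨i₀, hi₀⟩ := exists_maximal_chain reps
  have hnd : ∀ j, j ≠ i₀ → ∃ N, ∀ n, ¬ reps j n ≤ reps i₀ N := by
    intro j hj
    by_contra! hcon
    exact hne j i₀ hj ⟨hcon, hi₀ j hcon⟩
  obtain ⟨N, hN⟩ : ∃ N, ∀ j, j ≠ i₀ → ∀ n, ¬ reps j n ≤ reps i₀ (N + 1) := by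
    choose! f hf using hnd
    refine ⟨Finset.univ.sup f, fun j hj n hle => hf j hj n (hle.trans ?_)⟩
    exact (hreps i₀).strictAnti.antitone
      ((Finset.le_sup (Finset.mem_univ j)).trans (Nat.le_succ _))
  have hc : P.Proper (reps i₀ (N + 1)) := (hreps i₀).proper_succ hξU N
  set A := below ξ (reps i₀ (N + 1)) ∅
  have hU : P.IsUltra (P.flip ξ A) := hξU.flip_below hc.2 ∅
  have hrefl : AlmostEq (P.flip ξ A) (P.flip ξ A) := by simp [AlmostEq]
  refine ⟨{γ | P.IsUltra γ ∧ AlmostEq (P.flip ξ A) γ}, ⟨_, hU, rfl⟩, ?_, ?_,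
    P.flip ξ A, ⟨hU, hrefl⟩, ?_⟩
  · intro heq
    have hmem : P.flip ξ A ∈ {β | P.IsUltra β ∧ AlmostEq α β} := heq ▸ ⟨hU, hrefl⟩
    have hfin := (hαξ.symm.trans hmem.2).1
    have hinf := Set.infinite_range_of_injective
      ((hreps i₀).strictAnti.injective.comp (add_left_injective (N + 1)))
    refine hinf (hfin.subset ?_)
    rintro _ ⟨n, rfl⟩
    have hn := (hreps i₀).1 (n + (N + 1))
    refine ⟨hn, ?_⟩
    rintro (h | h)
    · exact h.2 ⟨hn, (hreps i₀).strictAnti.antitone (Nat.le_add_left _ _), fun _ hg => hg.elim⟩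
    · exact (hξU.1 _).1 hn h.1
  · exact fun β hβ => mem_closure_flip_below hdisc hβ.1 (hαξ.symm.trans hβ.2) hc
  · refine ⟨fun i => reps (i₀.succAbove i), fun i => ⟨fun n => ?_, (hreps _).2⟩,
      fun i j hij => hne _ _ (Fin.succAbove_right_injective.ne hij), fun e he => ?_⟩
    · exact Or.inl ⟨(hreps _).1 n, fun h => hN _ (Fin.succAbove_ne i₀ i) n h.2.1⟩
    · obtain ⟨k, hk⟩ := he.eventually_mem hdisc hξU hc
      have hmem := fun n => hk (n + k) (Nat.le_add_left _ _)
      obtain ⟨i, hi⟩ := hall (fun n => e (n + k))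
        ⟨fun n => (hmem n).1, fun n => by
          simpa [Nat.add_right_comm] using he.2 (n + k)⟩
      have hii : i ≠ i₀ := by
        rintro rfl
        obtain ⟨n, hn⟩ := hi.1 (N + 1)
        exact (hmem n).2 ⟨(hmem n).1, hn, fun _ hg => hg.elim⟩
      obtain ⟨j, rfl⟩ := Fin.exists_succAbove_eq hii
      exact ⟨j, (chainEquiv_shift he.strictAnti.antitone k).trans hi⟩
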